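/- arXiv:1901.09713 — 3 statements merged into one kernel-verified Lean document; each statement's English description precedes it below -/
import Mathlib

section
/- Let A be an abelian category with derived category D(A). Suppose there is a distinguished triangle W → W ⊕ Y → X → W⟦1⟧ in D(A) whose first morphism has components v : W → W and α : W → Y, with v nilpotent (so Y ≤_{Δ+nil} X). If Hⁱ(X) = 0 for all i ≠ 0 (X lies in the heart, i.e. X is a stalk complex), then Hⁱ(Y) = 0 for all i ≠ 0. -/
open CategoryTheory Category Limits Pretriangulated

/-- An endomorphism `v` of `W` is nilpotent if some positive power of it
(in the endomorphism ring `End W`) vanishes. -/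
def IsNilpotentEndo {T : Type*} [Category T] [Preadditive T] {W : T} (v : W ⟶ W) : Prop :=
  ∃ n : ℕ, 0 < n ∧ (show End W from v) ^ n = 0

/-- If a functor preserving zero morphisms sends a nilpotent endomorphism of `W` to an epimorphism,
then it sends `W` to a zero object. -/
lemma IsNilpotentEndo.isZero_obj_of_epi_map {T : Type*} [Category T] [Preadditive T]
    {B : Type*} [Category B] [HasZeroMorphisms B] (F : T ⥤ B) [F.PreservesZeroMorphisms]
    {W : T} {v : W ⟶ W} (hv : IsNilpotentEndo v) [Epi (F.map v)] : IsZero (F.obj W) := by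
  obtain ⟨n, -, hn⟩ := hv
  have epi_pow (k : ℕ) : Epi (F.map ((show End W from v) ^ k : End W)) := by
    induction k with
    | zero => rw [pow_zero, End.one_def, F.map_id]; infer_instance
    | succ k ih => rw [pow_succ, End.mul_def, F.map_comp]; exact epi_comp _ _
  have := epi_pow n
  refine IsZero.of_epi_eq_zero (F.map ((show End W from v) ^ n : End W)) ?_
  rw [hn]
  exact F.map_zero _ _

/-- in the derived category of an abelian category `A`, suppose
`Y ≤_{Δ+nil} X` via a distinguished triangle `W → W ⊕ Y → X → W⟦1⟧` whose first
morphism has components `v : W ⟶ W` (nilpotent) and `α : W ⟶ Y`. If `Hⁱ(X) = 0`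
for all `i ≠ 0`, then `Hⁱ(Y) = 0` for all `i ≠ 0`. -/
theorem stmt11 {A : Type*} [Category A] [Abelian A] [HasDerivedCategory A]
    (W Y X : DerivedCategory A) (v : W ⟶ W) (α : W ⟶ Y)
    (hv : IsNilpotentEndo v)
    (g : W ⊞ Y ⟶ X) (h : X ⟶ W⟦(1 : ℤ)⟧)
    (hT : Triangle.mk (biprod.lift v α) g h ∈ distTriang (DerivedCategory A))
    (hX : ∀ i : ℤ, i ≠ 0 → IsZero ((DerivedCategory.homologyFunctor A i).obj X)) :
    ∀ i : ℤ, i ≠ 0 → IsZero ((DerivedCategory.homologyFunctor A i).obj Y) := by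
  intro i hi
  let F := DerivedCategory.homologyFunctor A i
  have : Epi (F.map (biprod.lift v α)) :=
    (DerivedCategory.HomologySequence.epi_homologyMap_mor₁_iff _ hT i).2
      ((hX i hi).eq_of_tgt _ _)
  have : Epi (F.map v) := by
    rw [← biprod.lift_fst v α, F.map_comp]
    exact epi_comp _ _
  have : Epi (F.map α) := by
    rw [← biprod.lift_snd v α, F.map_comp]
    exact epi_comp _ _
  exact IsZero.of_epi (F.map α) (hv.isZero_obj_of_epi_map F)
end

section
/- Let A be an abelian category with derived category D(A), and suppose f : Z → Z is a monomorphism in A that is not an epimorphism. Let X be the stalk complex (cokernel f)[0] in D(A). Then: (a) there is a distinguished triangle Z[0] →^{f[0]} Z[0] → X → Z[0]⟦1⟧, so 0 ≤_Δ X and X ≇ 0; and (b) 0 ⊀_{Δ+nil} X, i.e. X is not related to 0 under the transitive closure of the relation ≤_{Δ+nil}: there is no finite chain 0 = X₀ ≤_{Δ+nil} X₁ ≤_{Δ+nil} ⋯ ≤_{Δ+nil} Xₙ = X in D(A). -/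
open CategoryTheory Category Limits Pretriangulated ZeroObject

/-- `M ≤_{Δ+nil} N` : there are an object `W` and a distinguished triangle
`W → W ⊕ M → N → W⟦1⟧` whose first morphism has components `v : W ⟶ W` (nilpotent)
and `u : W ⟶ M`. -/
def DegNil (T : Type*) [Category T] [Preadditive T] [HasZeroObject T] [HasShift T ℤ]
    [∀ n : ℤ, (shiftFunctor T n).Additive] [Pretriangulated T] [HasBinaryBiproducts T]
    (M N : T) : Prop :=
  ∃ (W : T) (v : W ⟶ W) (u : W ⟶ M) (g : W ⊞ M ⟶ N) (h : N ⟶ W⟦(1 : ℤ)⟧),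
    IsNilpotentEndo v ∧ Triangle.mk (biprod.lift v u) g h ∈ distTriang T

namespace IsNilpotentEndo

variable {T C : Type*} [Category T] [Preadditive T] [Category C] [Preadditive C]
  {W : T} {v : W ⟶ W}

/-- A functor preserving zero morphisms which sends a nilpotent endomorphism to an epimorphism
kills the object. -/
lemma isZero_obj_of_epi (hv : IsNilpotentEndo v) (F : T ⥤ C) [F.PreservesZeroMorphisms]
    [Epi (F.map v)] : IsZero (F.obj W) := by
  obtain ⟨n, -, hn⟩ := hv
  have hepi (k : ℕ) : Epi (F.map ((show End W from v) ^ k : End W)) := by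
    induction k with
    | zero => rw [pow_zero, End.one_def, F.map_id]; infer_instance
    | succ k ih => rw [pow_succ, End.mul_def, F.map_comp]; exact epi_comp _ _
  have h := hepi n
  rw [hn, show F.map (0 : End W) = 0 from F.map_zero W W] at h
  exact IsZero.of_epi_zero (F.obj W) (F.obj W)

/-- A functor preserving zero morphisms which sends a nilpotent endomorphism to a monomorphism
kills the object. -/
lemma isZero_obj_of_mono (hv : IsNilpotentEndo v) (F : T ⥤ C) [F.PreservesZeroMorphisms]
    [Mono (F.map v)] : IsZero (F.obj W) := by
  obtain ⟨n, -, hn⟩ := hv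
  have hmono (k : ℕ) : Mono (F.map ((show End W from v) ^ k : End W)) := by
    induction k with
    | zero => rw [pow_zero, End.one_def, F.map_id]; infer_instance
    | succ k ih => rw [pow_succ, End.mul_def, F.map_comp]; exact mono_comp _ _
  have h := hmono n
  rw [hn, show F.map (0 : End W) = 0 from F.map_zero W W] at h
  exact IsZero.of_mono_zero (F.obj W) (F.obj W)

end IsNilpotentEndo

namespace DerivedCategory

variable {A : Type*} [Category A] [Abelian A] [HasDerivedCategory A]

lemma isZero_of_isZero_homology {X : DerivedCategory A}
    (hX : ∀ i : ℤ, IsZero ((homologyFunctor A i).obj X)) : IsZero X := by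
  have : IsIso (0 : X ⟶ 0) := (isIso_iff A _).2 fun i ↦
    (hX i).isIso ((homologyFunctor A i).map_isZero (isZero_zero _)) _
  exact (isZero_zero _).of_iso (asIso (0 : X ⟶ 0))

section

variable {W M N : DerivedCategory A} {v : W ⟶ W} {u : W ⟶ M} {g : W ⊞ M ⟶ N}
  {h : N ⟶ W⟦(1 : ℤ)⟧} (hv : IsNilpotentEndo v)
  (hT : Triangle.mk (biprod.lift v u) g h ∈ distTriang (DerivedCategory A))

include hv hT

lemma isZero_homology_of_isNilpotentEndo {i : ℤ} (hN : IsZero ((homologyFunctor A i).obj N)) :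
    IsZero ((homologyFunctor A i).obj W) ∧ IsZero ((homologyFunctor A i).obj M) := by
  have hepi : Epi ((homologyFunctor A i).map (biprod.lift v u)) :=
    (HomologySequence.epi_homologyMap_mor₁_iff _ hT i).2 (hN.eq_of_tgt _ _)
  have hW : IsZero ((homologyFunctor A i).obj W) := by
    have : Epi ((homologyFunctor A i).map v) := by
      rw [← biprod.lift_fst v u, Functor.map_comp]
      exact epi_comp _ _
    exact hv.isZero_obj_of_epi _
  have : Epi ((homologyFunctor A i).map u) := by
    rw [← biprod.lift_snd v u, Functor.map_comp]
    exact epi_comp _ _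
  exact ⟨hW, hW.of_epi ((homologyFunctor A i).map u)⟩

lemma isZero_of_isNilpotentEndo_of_isZero (hM : IsZero M)
    (hN : ∀ i : ℤ, i ≠ 0 → IsZero ((homologyFunctor A i).obj N)) : IsZero N := by
  have hW : IsZero W := isZero_of_isZero_homology fun i ↦ by
    by_cases hi : i = 0
    · subst hi
      have hmono : Mono ((homologyFunctor A 0).map (biprod.lift v u)) :=
        (HomologySequence.mono_homologyMap_mor₁_iff _ hT (-1) 0).2
          ((hN (-1) (by lia)).eq_of_src _ _)
      have : Mono (biprod.fst : W ⊞ M ⟶ W) := ⟨fun a b hab ↦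
        biprod.hom_ext _ _ hab (hM.eq_of_tgt _ _)⟩
      have : IsIso (biprod.fst : W ⊞ M ⟶ W) := isIso_of_mono_of_isSplitEpi _
      have : Mono ((homologyFunctor A 0).map v) := by
        rw [← biprod.lift_fst v u, Functor.map_comp]
        exact mono_comp _ _
      exact hv.isZero_obj_of_mono _
    · exact (isZero_homology_of_isNilpotentEndo hv hT (hN i hi)).1
  refine Triangle.isZero₃_of_isZero₁₂ _ hT hW ?_
  exact (biprod_isZero_iff W M).2 ⟨hW, hM⟩

end

/-- An object with cohomology concentrated in degree `0` which is reachable from `0` by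
a chain of nilpotent degenerations is zero. -/
lemma isZero_of_transGen_degNil {X : DerivedCategory A}
    (hX : Relation.TransGen (DegNil (DerivedCategory A)) 0 X)
    (hX₀ : ∀ i : ℤ, i ≠ 0 → IsZero ((homologyFunctor A i).obj X)) : IsZero X := by
  induction hX with
  | single hd =>
    obtain ⟨W, v, u, g, h, hv, hT⟩ := hd
    exact isZero_of_isNilpotentEndo_of_isZero hv hT (isZero_zero _) hX₀
  | tail _ hd ih =>
    obtain ⟨W, v, u, g, h, hv, hT⟩ := hd
    exact isZero_of_isNilpotentEndo_of_isZero hv hT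
      (ih fun i hi ↦ (isZero_homology_of_isNilpotentEndo hv hT (hX₀ i hi)).2) hX₀

lemma isZero_homology_singleFunctor_obj (Y : A) {n i : ℤ} (hi : i ≠ n) :
    IsZero ((homologyFunctor A i).obj ((singleFunctor A n).obj Y)) := by
  rcases lt_or_gt_of_ne hi with hi | hi
  · exact isZero_of_isGE _ n i hi
  · exact isZero_of_isLE _ n i hi

end DerivedCategory

/-- let `f : Z ⟶ Z` be a monomorphism in an abelian category `A` that
is not an epimorphism, and let `X = (coker f)[0]` in `D(A)`. Then (a) there is a
distinguished triangle `Z[0] →^{f[0]} Z[0] → X → Z[0]⟦1⟧`, so `0 ≤_Δ X`, and `X` is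
nonzero; and (b) there is no finite chain
`0 = X₀ ≤_{Δ+nil} X₁ ≤_{Δ+nil} ⋯ ≤_{Δ+nil} Xₙ = X`, i.e. `0 ⊀_{Δ+nil} X` for the
transitive closure of `≤_{Δ+nil}`. -/
theorem stmt14 {A : Type*} [Category A] [Abelian A] [HasDerivedCategory A]
    (Z : A) (f : Z ⟶ Z) (hf : Mono f) (hnf : ¬ Epi f) :
    (∃ (g : (DerivedCategory.singleFunctor A 0).obj Z ⟶
          (DerivedCategory.singleFunctor A 0).obj (cokernel f))
        (h : (DerivedCategory.singleFunctor A 0).obj (cokernel f) ⟶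
          ((DerivedCategory.singleFunctor A 0).obj Z)⟦(1 : ℤ)⟧),
        Triangle.mk ((DerivedCategory.singleFunctor A 0).map f) g h ∈
          distTriang (DerivedCategory A)) ∧
      ¬ IsZero ((DerivedCategory.singleFunctor A 0).obj (cokernel f)) ∧
      ¬ Relation.TransGen (DegNil (DerivedCategory A))
          0 ((DerivedCategory.singleFunctor A 0).obj (cokernel f)) := by
  have hS : (ShortComplex.mk f (cokernel.π f) (cokernel.condition f)).ShortExact :=
    { exact := ShortComplex.exact_cokernel f
      mono_f := hf
      epi_g := inferInstanceAs (Epi (cokernel.π f)) }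
  have hX : ¬ IsZero ((DerivedCategory.singleFunctor A 0).obj (cokernel f)) := fun h ↦ hnf <|
    Preadditive.epi_of_isZero_cokernel f <|
      ((DerivedCategory.homologyFunctor A 0).map_isZero h).of_iso
        ((DerivedCategory.singleFunctorCompHomologyFunctorIso A 0).app (cokernel f)).symm
  exact ⟨⟨_, _, hS.singleTriangle_distinguished⟩, hX, fun h ↦ hX <|
    DerivedCategory.isZero_of_transGen_degNil h fun _ hi ↦
      DerivedCategory.isZero_homology_singleFunctor_obj _ hi⟩
end

section
/- Let p be a prime. In the derived category D(Mod ℤ) of abelian groups, let X be the stalk complex (ℤ/pℤ)[0]. Then: (a) there is a distinguished triangle ℤ[0] → ℤ[0] → X → ℤ[0]⟦1⟧ whose first morphism is (the stalk of) multiplication by p, so 0 ≤_Δ X and hence [X] = 0 in K₀; and (b) 0 ⊀_{Δ+nil} X: there is no finite chain 0 = X₀ ≤_{Δ+nil} X₁ ≤_{Δ+nil} ⋯ ≤_{Δ+nil} Xₙ = X in D(Mod ℤ). -/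
open CategoryTheory Category Limits Pretriangulated ZeroObject

section NilpotentExtension

variable {R A B C E : Type*} [Ring R] [AddCommGroup A] [AddCommGroup B] [AddCommGroup C]
  [AddCommGroup E] [Module R A] [Module R B] [Module R C] [Module R E]

theorem subsingleton_of_isNilpotent_of_surjective {v : A →ₗ[R] A}
    (hv : IsNilpotent (v : Module.End R A)) (hsurj : Function.Surjective v) :
    Subsingleton A := by
  obtain ⟨n, hn⟩ := hv
  have h : Function.Surjective (v ^ n : Module.End R A) := by
    rw [Module.End.coe_pow]
    exact hsurj.iterate n
  rw [hn] at h
  refine ⟨fun a b => ?_⟩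
  obtain ⟨a, rfl⟩ := h a
  obtain ⟨b, rfl⟩ := h b
  rfl

/-- A module with a nilpotent endomorphism whose cokernel is finite is itself finite. -/
theorem finite_of_isNilpotent_of_finite_quotient_range {v : Module.End R A}
    (hv : IsNilpotent v) [Finite (A ⧸ LinearMap.range v)] : Finite A := by
  obtain ⟨n, hn⟩ := hv
  have key : ∀ k : ℕ, ∃ s : Set A, s.Finite ∧ ∀ a, ∃ b ∈ s, ∃ c, a = b + (v ^ k) c := by
    intro k
    induction k with
    | zero => exact ⟨{0}, Set.finite_singleton 0, fun a => ⟨0, rfl, a, by simp⟩⟩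
    | succ k ih =>
      obtain ⟨s, hs, h⟩ := ih
      have ht : (Set.range (Quotient.out : A ⧸ LinearMap.range v → A)).Finite :=
        Set.finite_range _
      refine ⟨Set.image2 (fun b c => b + (v ^ k) c) s _, hs.image2 _ ht, fun a => ?_⟩
      obtain ⟨b, hb, c, rfl⟩ := h a
      have hc : c - (Submodule.Quotient.mk (p := LinearMap.range v) c).out ∈
          LinearMap.range v := by
        rw [← Submodule.Quotient.eq]
        exact (Quotient.out_eq _).symm
      obtain ⟨d, hd⟩ := hc
      refine ⟨_, Set.mem_image2_of_mem hb (Set.mem_range_self (Submodule.Quotient.mk c)), d, ?_⟩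
      rw [pow_succ, Module.End.mul_apply, hd, map_sub]
      abel
  obtain ⟨s, hs, h⟩ := key n
  refine Set.finite_univ_iff.mp (hs.subset fun a _ => ?_)
  obtain ⟨b, hb, c, rfl⟩ := h a
  simpa [hn] using hb

theorem card_eq_of_exact_of_isNilpotent (e : E ≃ₗ[R] A × B) {f : A →ₗ[R] E} {g : E →ₗ[R] C}
    {v : Module.End R A} (hv : IsNilpotent v) (hfv : ∀ a, (e (f a)).1 = v a)
    (hf : Function.Injective f) (hfg : Function.Exact f g) (hg : Function.Surjective g)
    [Finite C] : Nat.card B = Nat.card C := by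
  have hker : LinearMap.ker g ≤ LinearMap.ker
      ((LinearMap.range v).mkQ ∘ₗ LinearMap.fst R A B ∘ₗ e.toLinearMap) := by
    intro x hx
    obtain ⟨a, rfl⟩ := (hfg x).mp hx
    simp [hfv]
  have : Finite (E ⧸ LinearMap.ker g) := Finite.of_equiv C
    (g.quotKerEquivOfSurjective hg).symm.toEquiv
  have : Finite (A ⧸ LinearMap.range v) := by
    refine Finite.of_surjective ((LinearMap.ker g).liftQ _ hker) fun x => ?_
    obtain ⟨a, rfl⟩ := Submodule.mkQ_surjective _ x
    exact ⟨Submodule.Quotient.mk (e.symm (a, 0)), by simp⟩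
  have : Finite A := finite_of_isNilpotent_of_finite_quotient_range hv
  have h1 : Nat.card E = Nat.card A * Nat.card B := by
    rw [Nat.card_congr e.toEquiv, Nat.card_prod]
  have h2 : Nat.card E = Nat.card A * Nat.card C := by
    rw [(LinearMap.ker g).card_eq_card_quotient_mul_card,
      Nat.card_congr (g.quotKerEquivOfSurjective hg).toEquiv, hfg.linearMap_ker_eq,
      ← Nat.card_congr (LinearEquiv.ofInjective f hf).toEquiv]
  exact Nat.eq_of_mul_eq_mul_left Nat.card_pos (h1.symm.trans h2)

end NilpotentExtension

/-- An additive functor to modules sends a biproduct to the product of the images. -/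
noncomputable def CategoryTheory.Functor.mapBiprodLinearEquiv {T : Type*} [Category T]
    [Preadditive T] [HasBinaryBiproducts T] {R : Type*} [Ring R] (F : T ⥤ ModuleCat R)
    [F.Additive] (X Y : T) : F.obj (X ⊞ Y) ≃ₗ[R] F.obj X × F.obj Y :=
  LinearEquiv.ofLinearMap
    ((F.map biprod.fst).hom.prod (F.map biprod.snd).hom)
    ((F.map biprod.inl).hom.coprod (F.map biprod.inr).hom)
    (by ext x <;> simp [← ModuleCat.comp_apply, ← F.map_comp])
    (by
      ext x
      change (F.map (biprod.fst : X ⊞ Y ⟶ X) ≫ F.map biprod.inl +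
        F.map (biprod.snd : X ⊞ Y ⟶ Y) ≫ F.map biprod.inr).hom x = x
      rw [← F.map_comp, ← F.map_comp, ← F.map_add, biprod.total, F.map_id]
      rfl)

theorem IsNilpotentEndo.isNilpotent_map {T : Type*} [Category T] [Preadditive T] {R : Type*}
    [Ring R] (F : T ⥤ ModuleCat R) [F.Additive] {W : T} {v : W ⟶ W} (hv : IsNilpotentEndo v) :
    IsNilpotent ((F.map v).hom : Module.End R (F.obj W)) := by
  obtain ⟨n, -, hn⟩ := hv
  have hpow : ∀ k : ℕ, ((F.map v).hom : Module.End R (F.obj W)) ^ k =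
      (F.map ((show End W from v) ^ k : End W)).hom := by
    intro k
    induction k with
    | zero =>
      rw [pow_zero, pow_zero, End.one_def, F.map_id]
      rfl
    | succ k ih =>
      rw [pow_succ, pow_succ, ih, End.mul_def, F.map_comp]
      rfl
  exact ⟨n, by rw [hpow, hn]; exact congrArg ModuleCat.Hom.hom (F.map_zero W W)⟩

namespace DerivedCategory

variable {R : Type*} [Ring R] [HasDerivedCategory (ModuleCat R)]

/-- The homology of `M` is concentrated in degree `0`, where it has cardinality `n`. -/
def HasStalkCard (n : ℕ) (M : DerivedCategory (ModuleCat R)) : Prop :=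
  (∀ i : ℤ, i ≠ 0 → IsZero ((homologyFunctor (ModuleCat R) i).obj M)) ∧
    Nat.card ((homologyFunctor (ModuleCat R) 0).obj M) = n

theorem hasStalkCard_singleFunctor (X : ModuleCat R) :
    HasStalkCard (Nat.card X) ((singleFunctor (ModuleCat R) 0).obj X) := by
  refine ⟨fun i hi => ?_, ?_⟩
  · rcases lt_or_gt_of_ne hi with h | h
    · exact isZero_of_isGE _ 0 i h
    · exact isZero_of_isLE _ 0 i h
  · exact Nat.card_congr
      ((singleFunctorCompHomologyFunctorIso (ModuleCat R) 0).app X).toLinearEquiv.toEquiv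

theorem not_hasStalkCard_zero {n : ℕ} (hn : n ≠ 1) :
    ¬ HasStalkCard n (0 : DerivedCategory (ModuleCat R)) := by
  intro h
  have := ModuleCat.subsingleton_of_isZero
    ((homologyFunctor (ModuleCat R) 0).map_isZero (isZero_zero _))
  exact hn (h.2.symm.trans Nat.card_unique)

/-- If `M` degenerates to `N` along a triangle with nilpotent component and `N` has finite
homology concentrated in degree `0`, then the same holds for `M`, with the same cardinality. -/
theorem HasStalkCard.of_degNil {n : ℕ} (hn : n ≠ 0) {M N : DerivedCategory (ModuleCat R)}
    (hMN : DegNil (DerivedCategory (ModuleCat R)) M N) (hN : HasStalkCard n N) :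
    HasStalkCard n M := by
  obtain ⟨W, v, u, g, h, hv, hT⟩ := hMN
  let H := homologyFunctor (ModuleCat R)
  have hfv (i : ℤ) (a : (H i).obj W) :
      ((H i).mapBiprodLinearEquiv W M ((H i).map (biprod.lift v u) a)).1 = (H i).map v a := by
    change (H i).map biprod.fst ((H i).map (biprod.lift v u) a) = _
    rw [← ModuleCat.comp_apply, ← Functor.map_comp, biprod.lift_fst]
  have hsub (i : ℤ) (hi : i ≠ 0) :
      Subsingleton ((H i).obj W) ∧ Subsingleton ((H i).obj M) := by
    have hepi : Epi ((H i).map (biprod.lift v u)) :=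
      (HomologySequence.epi_homologyMap_mor₁_iff _ hT i).mpr ((hN.1 i hi).eq_of_tgt _ _)
    have hsurj := ((H i).mapBiprodLinearEquiv W M).surjective.comp
      ((ModuleCat.epi_iff_surjective _).mp hepi)
    have hW : Subsingleton ((H i).obj W) :=
      subsingleton_of_isNilpotent_of_surjective (hv.isNilpotent_map (H i)) fun a => by
        obtain ⟨b, hb⟩ := hsurj (a, 0)
        exact ⟨b, (hfv i b).symm.trans (congrArg Prod.fst hb)⟩
    exact ⟨hW, (Prod.snd_surjective.comp hsurj).subsingleton⟩
  refine ⟨fun i hi => ?_, ?_⟩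
  · have := (hsub i hi).2
    exact ModuleCat.isZero_of_subsingleton _
  · have hmono : Mono ((H 0).map (biprod.lift v u)) :=
      (HomologySequence.mono_homologyMap_mor₁_iff _ hT (-1) 0).mpr
        ((hN.1 (-1) (by decide)).eq_of_src _ _)
    have := (hsub 1 one_ne_zero).1
    have hepi : Epi ((H 0).map g) :=
      (HomologySequence.epi_homologyMap_mor₂_iff _ hT 0 1).mpr
        ((ModuleCat.isZero_of_subsingleton ((H 1).obj W)).eq_of_tgt _ _)
    have hfin : Finite ((H 0).obj N) := Nat.finite_of_card_ne_zero (hN.2.trans_ne hn)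
    rw [← hN.2]
    exact card_eq_of_exact_of_isNilpotent ((H 0).mapBiprodLinearEquiv W M)
      (hv.isNilpotent_map (H 0)) (hfv 0) ((ModuleCat.mono_iff_injective _).mp hmono)
      ((ShortComplex.ShortExact.moduleCat_exact_iff_function_exact _).mp
        (HomologySequence.exact₂ _ hT 0))
      ((ModuleCat.epi_iff_surjective _).mp hepi)

theorem not_transGen_degNil_zero {n : ℕ} (h0 : n ≠ 0) (h1 : n ≠ 1)
    {N : DerivedCategory (ModuleCat R)} (hN : HasStalkCard n N) :
    ¬ Relation.TransGen (DegNil (DerivedCategory (ModuleCat R))) 0 N := by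
  intro h
  refine not_hasStalkCard_zero (R := R) h1 ?_
  induction h with
  | single h => exact hN.of_degNil h0 h
  | tail _ h ih => exact ih (hN.of_degNil h0 h)

end DerivedCategory

/-- The short complex `ℤ → ℤ → ℤ/n` given by multiplication by `n` and the quotient map. -/
def zmodShortComplex (n : ℕ) : ShortComplex (ModuleCat ℤ) :=
  ShortComplex.mk ((n : ℤ) • 𝟙 (ModuleCat.of ℤ ℤ))
    (ModuleCat.ofHom (Int.castAddHom (ZMod n)).toIntLinearMap : _ ⟶ ModuleCat.of ℤ (ZMod n))
    (by ext; simp)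

theorem zmodShortComplex_shortExact {n : ℕ} (hn : n ≠ 0) : (zmodShortComplex n).ShortExact := by
  have hf (x : ℤ) : (zmodShortComplex n).f x = (n : ℤ) * x := rfl
  have hg (x : ℤ) : (zmodShortComplex n).g x = (x : ZMod n) := rfl
  refine ModuleCat.shortComplex_shortExact _ (fun (x : ℤ) => ?_) (fun (x : ℤ) (y : ℤ) h => ?_)
    (fun x => ?_)
  · exact (ZMod.intCast_zmod_eq_zero_iff_dvd x n).trans
      ⟨fun ⟨c, hc⟩ => ⟨c, hc.symm⟩, fun ⟨c, hc⟩ => ⟨c, hc.symm⟩⟩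
  · exact mul_left_cancel₀ (M₀ := ℤ) (Nat.cast_ne_zero.mpr hn) ((hf x).symm.trans (h.trans (hf y)))
  · exact ZMod.intCast_surjective x

/-- let `p` be a prime and let `X = (ℤ/pℤ)[0]` in the derived category
of abelian groups. Then (a) there is a distinguished triangle
`ℤ[0] → ℤ[0] → X → ℤ[0]⟦1⟧` whose first morphism is the stalk of multiplication by
`p`, so `0 ≤_Δ X` and `φ(X) = φ(0)` for every invariant `φ` defining the class in
`K₀` (constant on isomorphism classes and additive on distinguished triangles); and
(b) there is no finite chain `0 = X₀ ≤_{Δ+nil} X₁ ≤_{Δ+nil} ⋯ ≤_{Δ+nil} Xₙ = X`. -/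
theorem stmt15 (p : ℕ) (hp : p.Prime) [HasDerivedCategory (ModuleCat ℤ)] :
    (∃ (g : (DerivedCategory.singleFunctor (ModuleCat ℤ) 0).obj (ModuleCat.of ℤ ℤ) ⟶
          (DerivedCategory.singleFunctor (ModuleCat ℤ) 0).obj (ModuleCat.of ℤ (ZMod p)))
        (h : (DerivedCategory.singleFunctor (ModuleCat ℤ) 0).obj (ModuleCat.of ℤ (ZMod p)) ⟶
          ((DerivedCategory.singleFunctor (ModuleCat ℤ) 0).obj (ModuleCat.of ℤ ℤ))⟦(1 : ℤ)⟧),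
        Triangle.mk
          ((DerivedCategory.singleFunctor (ModuleCat ℤ) 0).map
            ((p : ℤ) • (𝟙 (ModuleCat.of ℤ ℤ)))) g h ∈
          distTriang (DerivedCategory (ModuleCat ℤ))) ∧
    (∀ {G : Type} [AddCommGroup G] (φ : DerivedCategory (ModuleCat ℤ) → G),
        (∀ (A B : DerivedCategory (ModuleCat ℤ)), (A ≅ B) → φ A = φ B) →
        (∀ (Tr : Triangle (DerivedCategory (ModuleCat ℤ))),
          (Tr ∈ distTriang (DerivedCategory (ModuleCat ℤ))) →
            φ Tr.obj₂ = φ Tr.obj₁ + φ Tr.obj₃) →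
        φ ((DerivedCategory.singleFunctor (ModuleCat ℤ) 0).obj (ModuleCat.of ℤ (ZMod p)))
          = φ 0) ∧
    ¬ Relation.TransGen (DegNil (DerivedCategory (ModuleCat ℤ)))
        0 ((DerivedCategory.singleFunctor (ModuleCat ℤ) 0).obj (ModuleCat.of ℤ (ZMod p))) := by
  have hT := (zmodShortComplex_shortExact hp.ne_zero).singleTriangle_distinguished
  refine ⟨⟨_, _, hT⟩, fun φ _ hφ => ?_, ?_⟩
  · have hX := hφ _ hT
    have h0 := hφ _ (contractible_distinguished (0 : DerivedCategory (ModuleCat ℤ)))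
    exact (left_eq_add.mp hX).trans (left_eq_add.mp h0).symm
  · have hcard := DerivedCategory.hasStalkCard_singleFunctor (ModuleCat.of ℤ (ZMod p))
    rw [Nat.card_zmod p] at hcard
    exact DerivedCategory.not_transGen_degNil_zero hp.ne_zero hp.ne_one hcard
end
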